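/- (Intermediate identity in the proof of Theorem 4.) For all real parameters m > 0, k > 0, γ̄ > 0: ∫₀^∞ log₂(γ) · f(γ) dγ = (1/ln 2) · ∑_{i=0}^∞ ((m)_i / i!) · ∫₀^∞ ((m x)^m k^i / (k + m x)^{m+i}) · (H_i − γ_E + ln(x γ̄/(k+1))) · e^{−x} dx, with both sides convergent. -/

import Mathlib

open MeasureTheory Set

/-- Pochhammer symbol (rising factorial) `(m)_i = m(m+1)⋯(m+i−1)`. -/
noncomputable def poch (m : ℝ) (i : ℕ) : ℝ := ∏ j ∈ Finset.range i, (m + j)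

/-- `n`-th harmonic number `H_n = ∑_{j=1}^n 1/j` (with `H_0 = 0`). -/
noncomputable def harmonicR (n : ℕ) : ℝ := ∑ j ∈ Finset.range n, 1 / ((j : ℝ) + 1)

/-- Kummer confluent hypergeometric function `₁F₁(m, 1, z) = ∑_{i=0}^∞ ((m)_i/(i!)²) z^i`. -/
noncomputable def kummerM (m z : ℝ) : ℝ :=
  ∑' i : ℕ, poch m i / ((Nat.factorial i : ℝ) ^ 2) * z ^ i

/-- Kummer confluent hypergeometric function of the second kind
`U(a, b, z) = (1/Γ(a)) ∫₀^∞ e^{−zt} t^{a−1} (1+t)^{b−a−1} dt`. -/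
noncomputable def kummerU (a b z : ℝ) : ℝ :=
  (1 / Real.Gamma a) *
    ∫ t in Ioi (0 : ℝ), Real.exp (-z * t) * t ^ (a - 1) * (1 + t) ^ (b - a - 1)

/-- Conditional SNR density of the fdRLoS channel,
`f(γ|x)` with `k_x = k/x`, `γ̄_x = ((k+x)/(k+1))·γ̄`. -/
noncomputable def condPdf (m k γb x γ : ℝ) : ℝ :=
  (m ^ m * (1 + k / x)) / ((m + k / x) ^ m * ((k + x) / (k + 1) * γb)) *
    Real.exp (-((1 + k / x) / ((k + x) / (k + 1) * γb)) * γ) *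
    kummerM m ((k / x) * (1 + k / x) / (k / x + m) * (γ / ((k + x) / (k + 1) * γb)))

/-- Unconditional SNR density of the fdRLoS channel, `f(γ) = ∫₀^∞ f(γ|x) e^{−x} dx`. -/
noncomputable def pdfSNR (m k γb γ : ℝ) : ℝ :=
  ∫ x in Ioi (0 : ℝ), condPdf m k γb x γ * Real.exp (-x)

theorem poch_pos {m : ℝ} (hm : 0 < m) (i : ℕ) : 0 < poch m i :=
  Finset.prod_pos fun j _ => by positivity

theorem poch_succ_mul (m : ℝ) (i : ℕ) : poch m i * (m + i) = m * poch (m + 1) i := by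
  have h1 : poch m i * (m + i) = poch m (i + 1) := by simp [poch, Finset.prod_range_succ]
  rw [h1, poch, Finset.prod_range_succ', poch, mul_comm]
  simp only [Nat.cast_add, Nat.cast_one, Nat.cast_zero, add_zero]
  congr 1
  exact Finset.prod_congr rfl fun j _ => by ring

theorem poch_eq (m : ℝ) (i : ℕ) : poch m i = (ascPochhammer ℝ i).eval m := by
  induction i with
  | zero => simp [poch]
  | succ n ih => rw [ascPochhammer_succ_eval, ← ih]; simp [poch, Finset.prod_range_succ]

theorem hasSum_nb (m q : ℝ) (hq0 : 0 ≤ q) (hq1 : q < 1) :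
    HasSum (fun i : ℕ => poch m i / (Nat.factorial i : ℝ) * q ^ i) (1 / (1 - q) ^ m) := by
  have h := (Real.one_div_one_sub_rpow_hasFPowerSeriesOnBall_zero m).hasSum (y := q)
    (by simpa [enorm_eq_nnnorm, ← NNReal.coe_lt_coe, abs_of_nonneg hq0] using hq1)
  simp only [FormalMultilinearSeries.ofScalars_apply_eq, zero_add, smul_eq_mul] at h
  convert h using 2 with i
  congr 1
  rw [Ring.choose]
  have h2 := Ring.factorial_nsmul_multichoose_eq_ascPochhammer m i
  rw [Polynomial.ascPochhammer_smeval_eq_eval, ← poch_eq] at h2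
  rw [← h2, nsmul_eq_mul]
  have : (Nat.factorial i : ℝ) ≠ 0 := by positivity
  rw [mul_div_cancel_left₀ _ this]
  congr 1; ring_nf

open Real in
theorem log_gamma_int (i : ℕ) :
    ∫ t in Ioi (0:ℝ), t ^ i * (Real.log t * Real.exp (-t)) = i.factorial * (harmonicR i - eulerMascheroniConstant) := by
  have h := Complex.hasDerivAt_GammaIntegral (s := (i:ℂ)+1) (by simp; positivity)
  have h2 := Complex.hasDerivAt_Gamma_nat i
  have h3 : Complex.GammaIntegral =ᶠ[nhds ((i:ℂ)+1)] Complex.Gamma := by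
    have : {z : ℂ | 0 < z.re} ∈ nhds ((i:ℂ)+1) :=
      (isOpen_lt continuous_const Complex.continuous_re).mem_nhds (by simp; positivity)
    filter_upwards [this] with z hz
    exact (Complex.Gamma_eq_integral hz).symm
  have h4 := (h.congr_of_eventuallyEq h3.symm).unique h2
  have h5 : ∫ (t : ℝ) in Ioi 0, (t:ℂ) ^ ((i:ℂ) + 1 - 1) * ((Real.log t:ℂ) * (Real.exp (-t):ℂ)) =
     ((∫ t in Ioi (0:ℝ), t ^ i * (Real.log t * Real.exp (-t)) : ℝ) : ℂ) := by
    rw [← integral_complex_ofReal]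
    congr 1; ext t; simp
  rw [h5] at h4
  have h6 : (harmonic i : ℝ) = harmonicR i := by simp [harmonic, harmonicR]
  rw [← h6]
  apply Complex.ofReal_injective
  rw [h4]; push_cast; ring

/-- Gamma density with integer shape. -/
noncomputable def gk (i : ℕ) (a γ : ℝ) : ℝ :=
  a * (a * γ) ^ i / (Nat.factorial i : ℝ) * Real.exp (-(a * γ))

theorem gk_nonneg (i : ℕ) {a γ : ℝ} (ha : 0 < a) (hγ : 0 < γ) : 0 ≤ gk i a γ := by
  unfold gk; positivity

theorem gk_moment (i : ℕ) {a s : ℝ} (ha : 0 < a) (hs : -1 < s) :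
    IntegrableOn (fun γ => γ ^ s * gk i a γ) (Ioi 0) ∧
    ∫ γ in Ioi (0:ℝ), γ ^ s * gk i a γ = a ^ (-s) * (Real.Gamma (i + s + 1) / i.factorial) := by
  have hpos : 0 < (i:ℝ) + s + 1 := by
    have : (0:ℝ) ≤ i := Nat.cast_nonneg i
    linarith
  have h1 := Real.integral_rpow_mul_exp_neg_mul_Ioi hpos ha
  have h2 : IntegrableOn (fun t : ℝ => t ^ ((i:ℝ) + s + 1 - 1) * Real.exp (-(a * t))) (Ioi 0) := by
    by_contra hc
    rw [integral_undef hc] at h1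
    have := Real.Gamma_pos_of_pos hpos
    have : 0 < (1 / a) ^ ((i:ℝ) + s + 1) * Real.Gamma (i + s + 1) := by positivity
    linarith
  have h3 : EqOn (fun γ : ℝ => a ^ (i + 1) / i.factorial *
      (γ ^ ((i:ℝ) + s + 1 - 1) * Real.exp (-(a * γ)))) (fun γ => γ ^ s * gk i a γ) (Ioi 0) := by
    intro γ hγ
    have hγ : 0 < γ := hγ
    have : γ ^ ((i:ℝ) + s + 1 - 1) = γ ^ i * γ ^ s := by
      rw [add_sub_cancel_right, Real.rpow_add hγ, Real.rpow_natCast]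
    simp only [gk, this]
    rw [mul_pow]; ring
  refine ⟨IntegrableOn.congr_fun (h2.const_mul _) h3 measurableSet_Ioi, ?_⟩
  rw [← setIntegral_congr_fun measurableSet_Ioi h3, integral_const_mul, h1]
  have : (1 / a) ^ ((i:ℝ) + s + 1) = (a ^ (i + 1))⁻¹ * a ^ (-s) := by
    rw [one_div, Real.inv_rpow ha.le, ← Real.rpow_neg ha.le, ← Real.rpow_natCast,
      ← Real.rpow_neg ha.le, ← Real.rpow_add ha]
    congr 1; push_cast; ring
  rw [this]
  have : a ^ (i + 1) ≠ 0 := by positivity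
  field_simp

theorem gamma_half_le (i : ℕ) : Real.Gamma (i + (-(1/2)) + 1) / i.factorial ≤ 2 := by
  induction i with
  | zero =>
    have : ((0:ℕ):ℝ) + (-(1/2)) + 1 = 1/2 := by norm_num
    rw [this, Real.Gamma_one_half_eq]
    simp only [Nat.factorial_zero, Nat.cast_one, div_one]
    rw [Real.sqrt_le_left (by norm_num)]
    linarith [Real.pi_le_four]
  | succ n ih =>
    have h0 : (0:ℝ) < (n:ℝ) + (-(1/2)) + 1 := by
      have : (0:ℝ) ≤ n := Nat.cast_nonneg n
      linarith
    have h1 : ((n+1:ℕ):ℝ) + (-(1/2)) + 1 = ((n:ℝ) + (-(1/2)) + 1) + 1 := by push_cast; ring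
    rw [h1, Real.Gamma_add_one h0.ne', Nat.factorial_succ]
    refine le_trans ?_ ih
    have := Real.Gamma_pos_of_pos h0
    push_cast
    rw [mul_div_mul_comm]
    refine mul_le_of_le_one_left (by positivity) ?_
    rw [div_le_one (by positivity)]
    linarith

theorem abs_log_le {γ : ℝ} (hγ : 0 < γ) : |Real.log γ| ≤ γ ^ (1:ℝ) + 2 * γ ^ (-(1/2) : ℝ) := by
  have h1 := Real.log_le_sub_one_of_pos hγ
  have h2 := Real.log_le_sub_one_of_pos (Real.rpow_pos_of_pos hγ (-(1/2)))
  rw [Real.log_rpow hγ] at h2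
  have h3 := Real.rpow_pos_of_pos hγ (-(1/2))
  rw [Real.rpow_one, abs_le]
  constructor <;> linarith

theorem gk_maj (i : ℕ) {a : ℝ} (ha : 0 < a) :
    IntegrableOn (fun γ => (γ ^ (1:ℝ) + 2 * γ ^ (-(1/2) : ℝ)) * gk i a γ) (Ioi 0) ∧
    ∫ γ in Ioi (0:ℝ), (γ ^ (1:ℝ) + 2 * γ ^ (-(1/2) : ℝ)) * gk i a γ ≤
      (i + 1) * a ^ (-1 : ℝ) + 4 * a ^ (1/2 : ℝ) := by
  obtain ⟨h1, h2⟩ := gk_moment i ha (show (-1:ℝ) < 1 by norm_num)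
  obtain ⟨h3, h4⟩ := gk_moment i ha (show (-1:ℝ) < -(1/2) by norm_num)
  have e : (fun γ => (γ ^ (1:ℝ) + 2 * γ ^ (-(1/2) : ℝ)) * gk i a γ) = fun γ =>
    γ ^ (1:ℝ) * gk i a γ + 2 * (γ ^ (-(1/2) : ℝ) * gk i a γ) := by
    ext γ; ring
  rw [e]
  refine ⟨h1.add (h3.const_mul 2), ?_⟩
  rw [integral_add h1 (h3.const_mul 2), integral_const_mul, h2, h4]
  have h5 : Real.Gamma (i + 1 + 1) / i.factorial = i + 1 := by
    have := Real.Gamma_nat_eq_factorial (i + 1)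
    push_cast at this
    rw [this, Nat.factorial_succ]
    have : (i.factorial : ℝ) ≠ 0 := by positivity
    push_cast; field_simp
  rw [h5, neg_neg]
  have := gamma_half_le i
  have h6 : 0 < a ^ (1/2 : ℝ) := by positivity
  nlinarith

theorem measurable_gk (i : ℕ) : Measurable (fun z : ℝ × ℝ => gk i z.1 z.2) := by
  unfold gk; fun_prop

theorem log_gk_int (i : ℕ) {a : ℝ} (ha : 0 < a) :
    IntegrableOn (fun γ => Real.log γ * gk i a γ) (Ioi 0) := by
  refine (gk_maj i ha).1.mono' ?_ ?_
  · have := (measurable_gk i).comp (measurable_prodMk_left (x := a))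
    exact (Real.measurable_log.mul this).aestronglyMeasurable
  · filter_upwards [ae_restrict_mem measurableSet_Ioi] with γ hγ
    rw [norm_mul, Real.norm_eq_abs, Real.norm_of_nonneg (gk_nonneg i ha hγ)]
    exact mul_le_mul_of_nonneg_right (abs_log_le hγ) (gk_nonneg i ha hγ)

theorem log_gk_integral (i : ℕ) {a : ℝ} (ha : 0 < a) :
    ∫ γ in Ioi (0:ℝ), Real.log γ * gk i a γ =
      harmonicR i - Real.eulerMascheroniConstant - Real.log a := by
  have hf : (i.factorial : ℝ) ≠ 0 := by positivity
  have h0 := log_gk_int i one_pos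
  obtain ⟨h1, h2⟩ := gk_moment i one_pos (show (-1:ℝ) < 0 by norm_num)
  simp only [Real.rpow_zero, one_mul] at h1 h2
  have h3 : ∫ γ in Ioi (0:ℝ), Real.log γ * gk i 1 γ =
      harmonicR i - Real.eulerMascheroniConstant := by
    have := log_gamma_int i
    have e : (fun γ => Real.log γ * gk i 1 γ) = fun γ => (i.factorial : ℝ)⁻¹ *
      (γ ^ i * (Real.log γ * Real.exp (-γ))) := by
      ext γ; simp only [gk, one_mul]; ring
    rw [e, integral_const_mul, this]
    field_simp
  have h4 : ∫ γ in Ioi (0:ℝ), gk i 1 γ = 1 := by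
    rw [h2, add_zero, Real.Gamma_nat_eq_factorial, div_self hf, neg_zero, Real.rpow_zero, one_mul]
  have h5 := integral_comp_mul_left_Ioi
    (fun t => a * (Real.log t * gk i 1 t - Real.log a * gk i 1 t)) 0 ha
  have h6 : ∫ t in Ioi (0:ℝ), a * (Real.log t * gk i 1 t - Real.log a * gk i 1 t) =
      a * (harmonicR i - Real.eulerMascheroniConstant - Real.log a) := by
    rw [integral_const_mul, integral_sub h0 (h1.const_mul _), integral_const_mul, h3, h4, mul_one]
  rw [mul_zero, h6, smul_eq_mul, inv_mul_cancel_left₀ ha.ne'] at h5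
  rw [← h5]
  refine setIntegral_congr_fun measurableSet_Ioi fun γ hγ => ?_
  have hγ : 0 < γ := hγ
  simp only [gk, one_mul]
  rw [Real.log_mul ha.ne' hγ.ne']
  ring

/-- Negative binomial weights. -/
noncomputable def wt (m k : ℝ) (i : ℕ) (x : ℝ) : ℝ :=
  poch m i / (Nat.factorial i : ℝ) * ((m * x) ^ m * k ^ i / (k + m * x) ^ (m + (i : ℝ)))

theorem wt_nonneg {m k x : ℝ} (hm : 0 < m) (hk : 0 < k) (hx : 0 < x) (i : ℕ) :
    0 ≤ wt m k i x := by
  have := poch_pos hm i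
  unfold wt; positivity

theorem condPdf_eq {m k γb x γ : ℝ} (hm : 0 < m) (hk : 0 < k) (hγb : 0 < γb)
    (hx : 0 < x) (hγ : 0 < γ) :
    condPdf m k γb x γ = ∑' i, wt m k i x * gk i ((k + 1) / γb / x) γ := by
  unfold condPdf kummerM
  rw [← tsum_mul_left]
  refine tsum_congr fun i => ?_
  have ha : (1 + k / x) / ((k + x) / (k + 1) * γb) = (k + 1) / γb / x := by
    have : k + x ≠ 0 := by positivity
    field_simp
    ring
  have h1 : (m ^ m * (1 + k / x)) / ((m + k / x) ^ m * ((k + x) / (k + 1) * γb)) =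
      ((m * x) ^ m / (k + m * x) ^ m) * ((k + 1) / γb / x) := by
    rw [mul_div_mul_comm, ha]
    have : m + k / x = (k + m * x) / x := by field_simp; ring
    rw [this, Real.div_rpow (by positivity) hx.le, Real.mul_rpow hm.le hx.le]
    field_simp
  have h2 : (k / x) * (1 + k / x) / (k / x + m) * (γ / ((k + x) / (k + 1) * γb)) =
      k / (k + m * x) * ((k + 1) / γb / x * γ) := by
    rw [← ha]
    have : k / x + m = (k + m * x) / x := by field_simp
    rw [this]
    field_simp
  rw [h1, h2, ha, wt, gk, Real.rpow_add (by positivity), Real.rpow_natCast, mul_pow, div_pow,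
    neg_mul]
  have := poch_pos hm i
  field_simp

theorem wt_eq {m k x : ℝ} (hm : 0 < m) (hk : 0 < k) (hx : 0 < x) (i : ℕ) :
    wt m k i x = (m * x / (k + m * x)) ^ m *
      (poch m i / (Nat.factorial i : ℝ) * (k / (k + m * x)) ^ i) := by
  rw [wt, Real.rpow_add (by positivity), Real.rpow_natCast, div_pow,
    Real.div_rpow (by positivity) (by positivity)]
  field_simp

theorem wt_sum {m k x A B : ℝ} (hm : 0 < m) (hk : 0 < k) (hx : 0 < x) (hA : 0 ≤ A) (hB : 0 ≤ B) :
    ∑' i : ℕ, ENNReal.ofReal (wt m k i x * ((i + 1) * A + B)) ≤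
      ENNReal.ofReal ((m + 1) * A * ((k + m * x) / (m * x)) + B) := by
  set p := m * x / (k + m * x) with hp
  set q := k / (k + m * x) with hq
  have hp0 : 0 < p := by positivity
  have hq0 : 0 ≤ q := by positivity
  have hpq : 1 - q = p := by rw [hp, hq]; field_simp; ring
  have hq1 : q < 1 := by linarith
  have s1 := hasSum_nb m q hq0 hq1
  have s2 := hasSum_nb (m + 1) q hq0 hq1
  rw [hpq] at s1 s2
  have s3 := (s2.mul_left ((m + 1) * A * p ^ m)).add (s1.mul_left (B * p ^ m))
  have e : (m + 1) * A * p ^ m * (1 / p ^ (m + 1)) + B * p ^ m * (1 / p ^ m) =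
      (m + 1) * A * ((k + m * x) / (m * x)) + B := by
    have h1 : (k + m * x) / (m * x) = 1 / p := by rw [hp, one_div_div]
    have h2 : p ^ m ≠ 0 := by positivity
    rw [h1, Real.rpow_add hp0, Real.rpow_one]
    field_simp
  rw [e] at s3
  rw [← s3.tsum_eq, ENNReal.ofReal_tsum_of_nonneg _ s3.summable]
  · refine ENNReal.tsum_le_tsum fun i => ENNReal.ofReal_le_ofReal ?_
    rw [wt_eq hm hk hx, ← hp, ← hq]
    have h1 := poch_pos hm i
    have h2 := poch_succ_mul m i
    have h3 : (i + 1) * poch m i ≤ (m + 1) * poch (m + 1) i := by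
      have : (m + 1) * poch (m + 1) i = (m + 1) / m * (poch m i * (m + i)) := by
        rw [h2]; field_simp
      rw [this]
      have : (m + 1) / m * (poch m i * (m + i)) = (m + 1 + i + i / m) * poch m i := by field_simp; ring
      rw [this]
      have : 0 ≤ (i:ℝ) / m := by positivity
      exact mul_le_mul_of_nonneg_right (by linarith) h1.le
    have h4 : 0 ≤ A * p ^ m * q ^ i / i.factorial := by positivity
    have := mul_le_mul_of_nonneg_right h3 h4
    calc _ = (i + 1) * poch m i * (A * p ^ m * q ^ i / i.factorial) +
          B * p ^ m * (poch m i / i.factorial * q ^ i) := by ring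
      _ ≤ (m + 1) * poch (m + 1) i * (A * p ^ m * q ^ i / i.factorial) +
          B * p ^ m * (poch m i / i.factorial * q ^ i) := by gcongr
      _ = _ := by ring
  · intro i
    have := poch_pos hm i
    have := poch_pos (show 0 < m + 1 by linarith) i
    positivity

theorem dom_int {m k c : ℝ} (hm : 0 < m) (hc : 0 < c) :
    IntegrableOn (fun x : ℝ => Real.exp (-x) * ((m + 1) * (c / x) ^ (-1 : ℝ) * ((k + m * x) / (m * x))
      + 4 * (c / x) ^ (1/2 : ℝ))) (Ioi 0) := by
  have i1 := Real.GammaIntegral_convergent (s := 1) (by norm_num)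
  have i2 := Real.GammaIntegral_convergent (s := 2) (by norm_num)
  have i3 := Real.GammaIntegral_convergent (s := 1/2) (by norm_num)
  have := ((i1.const_mul ((m + 1) * k / (m * c))).add (i2.const_mul ((m + 1) / c))).add
    (i3.const_mul (4 * c ^ (1/2 : ℝ)))
  refine IntegrableOn.congr_fun this ?_ measurableSet_Ioi
  intro x hx
  have hx : 0 < x := hx
  have e1 : x ^ ((1:ℝ) - 1) = 1 := by norm_num
  have e2 : x ^ ((2:ℝ) - 1) = x := by norm_num
  have e3 : x ^ ((1/2:ℝ) - 1) = (x ^ (1/2 : ℝ))⁻¹ := by rw [← Real.rpow_neg hx.le]; norm_num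
  simp only [Pi.add_apply, e1, e2, e3, Real.div_rpow hc.le hx.le, Real.rpow_neg_one]
  field_simp

/-- The terms of the expansion on the product space. -/
noncomputable def FF (m k c : ℝ) (i : ℕ) (z : ℝ × ℝ) : ℝ :=
  Real.log z.2 * (wt m k i z.1 * Real.exp (-z.1) * gk i (c / z.1) z.2)

theorem measurable_FF (m k c : ℝ) (i : ℕ) : Measurable (FF m k c i) := by
  unfold FF wt gk
  fun_prop

theorem FF_inner {m k c x : ℝ} (hm : 0 < m) (hk : 0 < k) (hc : 0 < c) (hx : 0 < x) (i : ℕ) :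
    ∫⁻ γ in Ioi (0:ℝ), ‖FF m k c i (x, γ)‖ₑ ≤ ENNReal.ofReal (Real.exp (-x)) *
      ENNReal.ofReal (wt m k i x * ((i + 1) * (c / x) ^ (-1 : ℝ) + 4 * (c / x) ^ (1/2 : ℝ))) := by
  have ha : 0 < c / x := by positivity
  have hw := wt_nonneg hm hk hx i
  obtain ⟨h1, h2⟩ := gk_maj i ha
  have h3 := h1.const_mul (wt m k i x * Real.exp (-x))
  calc _ ≤ ∫⁻ γ in Ioi (0:ℝ), ENNReal.ofReal (wt m k i x * Real.exp (-x) *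
        ((γ ^ (1:ℝ) + 2 * γ ^ (-(1/2) : ℝ)) * gk i (c / x) γ)) := by
        refine lintegral_mono_ae ?_
        filter_upwards [ae_restrict_mem measurableSet_Ioi] with γ hγ
        rw [← ofReal_norm]
        refine ENNReal.ofReal_le_ofReal ?_
        have hg := gk_nonneg i ha hγ
        rw [FF, norm_mul, Real.norm_eq_abs, Real.norm_of_nonneg (by positivity)]
        have := abs_log_le hγ
        calc _ ≤ (γ ^ (1:ℝ) + 2 * γ ^ (-(1/2) : ℝ)) *
              (wt m k i x * Real.exp (-x) * gk i (c / x) γ) := by gcongr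
          _ = _ := by ring
    _ = ENNReal.ofReal (∫ γ in Ioi (0:ℝ), wt m k i x * Real.exp (-x) *
        ((γ ^ (1:ℝ) + 2 * γ ^ (-(1/2) : ℝ)) * gk i (c / x) γ)) := by
        rw [ofReal_integral_eq_lintegral_ofReal h3]
        filter_upwards [ae_restrict_mem measurableSet_Ioi] with γ hγ
        have hg := gk_nonneg i ha hγ
        have hγ : 0 < γ := hγ
        simp only [Pi.zero_apply]
        positivity
    _ ≤ _ := by
        rw [← ENNReal.ofReal_mul (Real.exp_pos _).le, integral_const_mul]
        refine ENNReal.ofReal_le_ofReal ?_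
        calc _ ≤ wt m k i x * Real.exp (-x) *
              ((i + 1) * (c / x) ^ (-1 : ℝ) + 4 * (c / x) ^ (1/2 : ℝ)) := by gcongr
          _ = _ := by ring

theorem FF_fin {m k c : ℝ} (hm : 0 < m) (hk : 0 < k) (hc : 0 < c) :
    ∑' i, ∫⁻ z, ‖FF m k c i z‖ₑ ∂((volume.restrict (Ioi (0:ℝ))).prod (volume.restrict (Ioi (0:ℝ))))
      ≠ ⊤ := by
  have hmeas : ∀ i, Measurable (fun z => ‖FF m k c i z‖ₑ) := fun i => (measurable_FF m k c i).enorm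
  have e : ∀ i, ∫⁻ z, ‖FF m k c i z‖ₑ
      ∂((volume.restrict (Ioi (0:ℝ))).prod (volume.restrict (Ioi (0:ℝ)))) =
      ∫⁻ x in Ioi (0:ℝ), ∫⁻ γ in Ioi (0:ℝ), ‖FF m k c i (x, γ)‖ₑ := fun i =>
    lintegral_prod _ (hmeas i).aemeasurable
  simp only [e]
  rw [← lintegral_tsum fun i => (hmeas i).lintegral_prod_right'.aemeasurable]
  refine ne_top_of_le_ne_top (dom_int (k := k) hm hc).lintegral_lt_top.ne (lintegral_mono_ae ?_)
  filter_upwards [ae_restrict_mem measurableSet_Ioi] with x hx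
  have hx : 0 < x := hx
  refine (ENNReal.tsum_le_tsum fun i => FF_inner hm hk hc hx i).trans ?_
  rw [ENNReal.tsum_mul_left, ENNReal.ofReal_mul (Real.exp_pos _).le]
  gcongr
  exact wt_sum hm hk hx (by positivity) (by positivity)

theorem integrable_tsum_aux {α : Type*} [MeasurableSpace α] {μ : Measure α} {f : ℕ → α → ℝ}
    (hf : ∀ i, Measurable (f i)) (h : ∑' i, ∫⁻ a, ‖f i a‖ₑ ∂μ ≠ ⊤) :
    (∀ i, Integrable (f i) μ) ∧ Integrable (fun a => ∑' i, f i a) μ ∧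
    HasSum (fun i => ∫ a, f i a ∂μ) (∫ a, ∑' i, f i a ∂μ) := by
  have h1 : ∀ i, Integrable (f i) μ := fun i =>
    ⟨(hf i).aestronglyMeasurable, (ENNReal.ne_top_of_tsum_ne_top h i).lt_top⟩
  have hs : ∀ᵐ a ∂μ, Summable fun i => f i a := by
    have h' := h
    rw [← lintegral_tsum fun i => (hf i).enorm.aemeasurable] at h'
    filter_upwards [ae_lt_top' (AEMeasurable.tsum fun i => (hf i).enorm.aemeasurable) h'] with a ha
    exact (tsum_enorm_ne_top_iff_summable_norm.1 ha.ne).of_norm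
  refine ⟨h1, ⟨?_, ?_⟩, ?_⟩
  · refine aestronglyMeasurable_of_tendsto_ae Filter.atTop
      (f := fun n a => ∑ i ∈ Finset.range n, f i a) (fun n => ?_) ?_
    · exact (Finset.measurable_sum _ fun i _ => hf i).aestronglyMeasurable
    · filter_upwards [hs] with a ha
      exact ha.hasSum.tendsto_sum_nat
  · refine lt_of_le_of_lt (lintegral_mono fun a => enorm_tsum_le_tsum_enorm) ?_
    rw [lintegral_tsum fun i => (hf i).enorm.aemeasurable]
    exact h.lt_top
  · refine hasSum_integral_of_summable_integral_norm h1 ?_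
    have := ENNReal.summable_toReal h
    refine this.congr fun i => ?_
    rw [integral_norm_eq_lintegral_enorm (hf i).aestronglyMeasurable]

/-- Intermediate identity in the proof of Theorem 4:
`∫₀^∞ log₂(γ) f(γ) dγ = (1/ln 2) ∑_{i} ((m)_i/i!) ∫₀^∞ ((mx)^m k^i/(k+mx)^{m+i})
(H_i − γ_E + ln(xγ̄/(k+1))) e^{−x} dx`. -/
theorem ora_highSNR_intermediate (m k γb : ℝ) (hm : 0 < m) (hk : 0 < k) (hγb : 0 < γb) :
    IntegrableOn (fun γ : ℝ => Real.logb 2 γ * pdfSNR m k γb γ) (Ioi 0) ∧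
    (∀ i : ℕ, IntegrableOn (fun x : ℝ =>
      ((m * x) ^ m * k ^ i / (k + m * x) ^ (m + (i : ℝ))) *
        (harmonicR i - Real.eulerMascheroniConstant + Real.log (x * γb / (k + 1))) *
        Real.exp (-x)) (Ioi 0)) ∧
    Summable (fun i : ℕ => poch m i / (Nat.factorial i : ℝ) *
      ∫ x in Ioi (0 : ℝ), ((m * x) ^ m * k ^ i / (k + m * x) ^ (m + (i : ℝ))) *
        (harmonicR i - Real.eulerMascheroniConstant + Real.log (x * γb / (k + 1))) *
        Real.exp (-x)) ∧
    (∫ γ in Ioi (0 : ℝ), Real.logb 2 γ * pdfSNR m k γb γ) =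
      (1 / Real.log 2) * ∑' i : ℕ, poch m i / (Nat.factorial i : ℝ) *
        ∫ x in Ioi (0 : ℝ), ((m * x) ^ m * k ^ i / (k + m * x) ^ (m + (i : ℝ))) *
          (harmonicR i - Real.eulerMascheroniConstant + Real.log (x * γb / (k + 1))) *
          Real.exp (-x) := by

  set c := (k + 1) / γb with hcdef
  have hc : 0 < c := by positivity
  obtain ⟨h1, h2, h3⟩ := integrable_tsum_aux (measurable_FF m k c) (FF_fin hm hk hc)
  -- the left-hand side
  have hL : ∀ γ ∈ Ioi (0:ℝ), (1 / Real.log 2) * (∫ x in Ioi (0:ℝ), ∑' i, FF m k c i (x, γ)) =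
      Real.logb 2 γ * pdfSNR m k γb γ := by
    intro γ hγ
    have : ∫ x in Ioi (0:ℝ), ∑' i, FF m k c i (x, γ) =
        ∫ x in Ioi (0:ℝ), Real.log γ * (condPdf m k γb x γ * Real.exp (-x)) := by
      refine setIntegral_congr_fun measurableSet_Ioi fun x hx => ?_
      simp only [FF]
      rw [condPdf_eq hm hk hγb hx hγ, ← tsum_mul_right, ← tsum_mul_left]
      exact tsum_congr fun i => by rw [← hcdef]; ring
    rw [this, integral_const_mul, pdfSNR, Real.logb]
    ring
  -- the right-hand side
  have hR : ∀ i : ℕ, ∀ x ∈ Ioi (0:ℝ), ∫ γ in Ioi (0:ℝ), FF m k c i (x, γ) =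
      poch m i / (Nat.factorial i : ℝ) * (((m * x) ^ m * k ^ i / (k + m * x) ^ (m + (i : ℝ))) *
        (harmonicR i - Real.eulerMascheroniConstant + Real.log (x * γb / (k + 1))) *
        Real.exp (-x)) := by
    intro i x hx
    have hx : 0 < x := hx
    have e : (fun γ => FF m k c i (x, γ)) = fun γ => (wt m k i x * Real.exp (-x)) *
        (Real.log γ * gk i (c / x) γ) := by
      ext γ; simp only [FF]; ring
    have e2 : x * γb / (k + 1) = (c / x)⁻¹ := by rw [hcdef]; field_simp
    rw [e, integral_const_mul, log_gk_integral i (by positivity), e2, Real.log_inv, wt]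
    ring
  have hI : ∀ i, ∫ z, FF m k c i z
      ∂((volume.restrict (Ioi (0:ℝ))).prod (volume.restrict (Ioi (0:ℝ)))) =
      poch m i / (Nat.factorial i : ℝ) *
      ∫ x in Ioi (0 : ℝ), ((m * x) ^ m * k ^ i / (k + m * x) ^ (m + (i : ℝ))) *
        (harmonicR i - Real.eulerMascheroniConstant + Real.log (x * γb / (k + 1))) *
        Real.exp (-x) := by
    intro i
    rw [integral_prod _ (h1 i), setIntegral_congr_fun measurableSet_Ioi (hR i), integral_const_mul]
  simp only [hI] at h3
  refine ⟨?_, ?_, h3.summable, ?_⟩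
  · exact IntegrableOn.congr_fun (h2.integral_prod_right.const_mul (1 / Real.log 2)) hL
      measurableSet_Ioi
  · intro i
    have hp : poch m i / (Nat.factorial i : ℝ) ≠ 0 := by
      have := poch_pos hm i
      positivity
    have := IntegrableOn.congr_fun (h1 i).integral_prod_left (hR i) measurableSet_Ioi
    exact (integrable_const_mul_iff hp.isUnit _).1 this
  · rw [h3.tsum_eq, integral_prod_symm _ h2, ← integral_const_mul]
    exact (setIntegral_congr_fun measurableSet_Ioi hL).symm
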